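/- There exists a MALL agenda satisfying the median property together with a profile of MALL-consistent (but not robustly consistent) judgment sets whose majority outcome is MALL-inconsistent. Concretely, let p, c be distinct atoms: the agenda Φ = {p, ¬p, c, ¬c, c⊸1, ¬(c⊸1)} satisfies the median property; for n = 3 agents, the profile J_1 = {p, ¬p, c}, J_2 = {p, c, c⊸1}, J_3 = {¬p, c, c⊸1} consists of MALL-consistent judgment sets, and the majority outcome {p, ¬p, c, c⊸1} is MALL-inconsistent (the sequent p, ¬p, c, c⊸1 ⊢ is derivable in MALL). -/

import Mathlib

namespace Stmt10

/-- Formulas of multiplicative additive linear logic (MALL). -/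
inductive MForm : Type
  | atom  : ℕ → MForm
  | neg   : MForm → MForm
  | tens  : MForm → MForm → MForm         -- ⊗
  | parr  : MForm → MForm → MForm         -- ⅋
  | lolli : MForm → MForm → MForm         -- ⊸
  | one   : MForm                         -- 1
  | bot   : MForm                         -- ⊥
  | awith : MForm → MForm → MForm         -- &
  | aplus : MForm → MForm → MForm         -- ⊕
  | top   : MForm                         -- ⊤
  | zero  : MForm                         -- 0
  deriving DecidableEq

/-- Two-sided sequent calculus for MALL on multisets (no weakening, no contraction). -/
inductive MDeriv : Multiset MForm → Multiset MForm → Prop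
  | ax (A) : MDeriv {A} {A}
  | cut {Γ Δ Γ' Δ' A} : MDeriv (A ::ₘ Γ) Δ → MDeriv Γ' (A ::ₘ Δ') →
      MDeriv (Γ + Γ') (Δ + Δ')
  | negL {Γ Δ A} : MDeriv Γ (A ::ₘ Δ) → MDeriv (MForm.neg A ::ₘ Γ) Δ
  | negR {Γ Δ A} : MDeriv (A ::ₘ Γ) Δ → MDeriv Γ (MForm.neg A ::ₘ Δ)
  | tensR {Γ Δ Γ' Δ' A B} : MDeriv Γ (A ::ₘ Δ) → MDeriv Γ' (B ::ₘ Δ') →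
      MDeriv (Γ + Γ') (MForm.tens A B ::ₘ (Δ + Δ'))
  | tensL {Γ Δ A B} : MDeriv (A ::ₘ B ::ₘ Γ) Δ → MDeriv (MForm.tens A B ::ₘ Γ) Δ
  | parrL {Γ Δ Γ' Δ' A B} : MDeriv (A ::ₘ Γ) Δ → MDeriv (B ::ₘ Γ') Δ' →
      MDeriv (MForm.parr A B ::ₘ (Γ + Γ')) (Δ + Δ')
  | parrR {Γ Δ A B} : MDeriv Γ (A ::ₘ B ::ₘ Δ) → MDeriv Γ (MForm.parr A B ::ₘ Δ)
  | lolliL {Γ Δ Γ' Δ' A B} : MDeriv Γ (A ::ₘ Δ) → MDeriv (B ::ₘ Γ') Δ' →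
      MDeriv (MForm.lolli A B ::ₘ (Γ + Γ')) (Δ + Δ')
  | lolliR {Γ Δ A B} : MDeriv (A ::ₘ Γ) (B ::ₘ Δ) → MDeriv Γ (MForm.lolli A B ::ₘ Δ)
  | oneR : MDeriv 0 {MForm.one}
  | oneL {Γ Δ} : MDeriv Γ Δ → MDeriv (MForm.one ::ₘ Γ) Δ
  | botL : MDeriv {MForm.bot} 0
  | botR {Γ Δ} : MDeriv Γ Δ → MDeriv Γ (MForm.bot ::ₘ Δ)
  | withR {Γ Δ A B} : MDeriv Γ (A ::ₘ Δ) → MDeriv Γ (B ::ₘ Δ) →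
      MDeriv Γ (MForm.awith A B ::ₘ Δ)
  | withL1 {Γ Δ A B} : MDeriv (A ::ₘ Γ) Δ → MDeriv (MForm.awith A B ::ₘ Γ) Δ
  | withL2 {Γ Δ A B} : MDeriv (B ::ₘ Γ) Δ → MDeriv (MForm.awith A B ::ₘ Γ) Δ
  | plusL {Γ Δ A B} : MDeriv (A ::ₘ Γ) Δ → MDeriv (B ::ₘ Γ) Δ →
      MDeriv (MForm.aplus A B ::ₘ Γ) Δ
  | plusR1 {Γ Δ A B} : MDeriv Γ (A ::ₘ Δ) → MDeriv Γ (MForm.aplus A B ::ₘ Δ)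
  | plusR2 {Γ Δ A B} : MDeriv Γ (B ::ₘ Δ) → MDeriv Γ (MForm.aplus A B ::ₘ Δ)
  | topR (Γ Δ) : MDeriv Γ (MForm.top ::ₘ Δ)
  | zeroL (Γ Δ) : MDeriv (MForm.zero ::ₘ Γ) Δ

/-- MALL-inconsistency of a multiset: Γ ⊢ (empty succedent) is derivable. -/
def MInconsistent (Γ : Multiset MForm) : Prop := MDeriv Γ 0

/-- Robust consistency: every submultiset is MALL-consistent. -/
def robustlyConsistent (Γ : Multiset MForm) : Prop :=
  ∀ Δ : Multiset MForm, Δ ≤ Γ → ¬ MInconsistent Δ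

/-- The complement ∼φ. -/
def MForm.compl : MForm → MForm
  | .neg ψ => ψ
  | φ      => .neg φ

def isTautology (φ : MForm) : Prop := MDeriv 0 {φ}
def isContradiction (φ : MForm) : Prop := MDeriv {φ} 0

/-- A MALL agenda: finite, closed under complement, no tautologies or contradictions. -/
def isAgenda (Φ : Finset MForm) : Prop :=
  (∀ φ ∈ Φ, φ.compl ∈ Φ) ∧ ∀ φ ∈ Φ, ¬ isTautology φ ∧ ¬ isContradiction φ

def completeOn (Φ J : Finset MForm) : Prop := ∀ φ ∈ Φ, φ ∈ J ∨ φ.compl ∈ J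

def complementFree (J : Finset MForm) : Prop := ∀ φ ∈ J, φ.compl ∉ J

/-- Profiles of robustly consistent and complete judgment sets over Φ. -/
def ratProfile (n : ℕ) (Φ : Finset MForm) (J : Fin n → Finset MForm) : Prop :=
  ∀ i, J i ⊆ Φ ∧ robustlyConsistent (J i).val ∧ completeOn Φ (J i)

def nsupp (n : ℕ) (J : Fin n → Finset MForm) (φ : MForm) : ℕ :=
  (Finset.univ.filter (fun i => φ ∈ J i)).card

/-- The majority rule. -/
def maj (n : ℕ) (Φ : Finset MForm) (J : Fin n → Finset MForm) : Finset MForm :=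
  Φ.filter (fun φ => n < 2 * nsupp n J φ)

def minimallyInconsistent (Y : Finset MForm) : Prop :=
  MInconsistent Y.val ∧ ∀ Z ⊂ Y, ¬ MInconsistent Z.val

def medianProperty (Φ : Finset MForm) : Prop :=
  ∀ Y ⊆ Φ, minimallyInconsistent Y → Y.card ≤ 2

def p : MForm := .atom 0
def c : MForm := .atom 1

/-- The agenda {p, ¬p, c, ¬c, c⊸1, ¬(c⊸1)}. -/
def Φ : Finset MForm := {p, .neg p, c, .neg c, c.lolli .one, .neg (c.lolli .one)}

/-- The profile J₁ = {p,¬p,c}, J₂ = {p,c,c⊸1}, J₃ = {¬p,c,c⊸1}. -/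
def Jprof : Fin 3 → Finset MForm := fun i =>
  if i = 0 then {p, .neg p, c}
  else if i = 1 then {p, c, c.lolli .one}
  else {.neg p, c, c.lolli .one}

/-- Orthogonal in the phase space `ℤ` with pole `{0}`. -/
def orth (X : Set ℤ) : Set ℤ := {y | ∀ x ∈ X, x + y = 0}

lemma orth_anti {X Y : Set ℤ} (h : X ⊆ Y) : orth Y ⊆ orth X := fun _ hy x hx => hy x (h hx)

lemma sub_orth2 (X : Set ℤ) : X ⊆ orth (orth X) := fun x hx y hy => by
  have := hy x hx
  omega

lemma orth3 (X : Set ℤ) : orth (orth (orth X)) = orth X :=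
  Set.Subset.antisymm (orth_anti (sub_orth2 X)) (sub_orth2 _)

/-- Phase semantics. -/
def P (a b : ℤ) : MForm → Set ℤ
  | .atom n => if n = 0 then {a} else {b}
  | .neg A => orth (P a b A)
  | .tens A B => orth (orth {z | ∃ x ∈ P a b A, ∃ y ∈ P a b B, x + y = z})
  | .parr A B => orth {z | ∃ x ∈ orth (P a b A), ∃ y ∈ orth (P a b B), x + y = z}
  | .lolli A B => orth {z | ∃ x ∈ P a b A, ∃ y ∈ orth (P a b B), x + y = z}
  | .one => {0}
  | .bot => {0}
  | .awith A B => P a b A ∩ P a b B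
  | .aplus A B => orth (orth (P a b A) ∩ orth (P a b B))
  | .top => Set.univ
  | .zero => ∅

lemma orth_singleton (a : ℤ) : orth {a} = {-a} := by
  ext y; simp only [orth, Set.mem_singleton_iff, forall_eq, Set.mem_ofPred_eq]; omega

lemma orth_univ : orth Set.univ = ∅ := by
  ext y
  simp only [orth, Set.mem_univ, true_imp_iff, Set.mem_ofPred_eq, Set.mem_empty_iff_false, iff_false]
  intro h
  have h0 := h 0
  have h1 := h 1
  omega

lemma orth_empty : orth ∅ = Set.univ := by
  ext y; simp [orth]

lemma closed (a b : ℤ) (A : MForm) : orth (orth (P a b A)) = P a b A := by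
  induction A with
  | atom n => simp only [P]; split_ifs <;> simp [orth_singleton]
  | awith A B hA hB =>
    refine Set.Subset.antisymm ?_ (sub_orth2 _)
    refine Set.subset_inter ?_ ?_
    · exact (orth_anti (orth_anti Set.inter_subset_left)).trans hA.subset
    · exact (orth_anti (orth_anti Set.inter_subset_right)).trans hB.subset
  | _ => simp [P, orth3, orth_singleton, orth_univ, orth_empty]

open scoped Pointwise in
/-- Sum of the interpretations of a multiset. -/
def S (F : MForm → Set ℤ) (Γ : Multiset MForm) : Set ℤ := (Γ.map F).sum

lemma S_zero {F : MForm → Set ℤ} {x : ℤ} : x ∈ S F 0 ↔ x = 0 := by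
  simp [S]

lemma S_cons {F : MForm → Set ℤ} {A Γ} {x : ℤ} :
    x ∈ S F (A ::ₘ Γ) ↔ ∃ u ∈ F A, ∃ v ∈ S F Γ, u + v = x := by
  simp [S, Set.mem_add]

lemma S_add {F : MForm → Set ℤ} {Γ Δ} {x : ℤ} :
    x ∈ S F (Γ + Δ) ↔ ∃ u ∈ S F Γ, ∃ v ∈ S F Δ, u + v = x := by
  simp [S, Set.mem_add]

lemma S_single {F : MForm → Set ℤ} {A} {x : ℤ} : x ∈ S F {A} ↔ x ∈ F A := by
  simp [S]

/-- Negative interpretation. -/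
def N (a b : ℤ) (A : MForm) : Set ℤ := orth (P a b A)

/-- Validity of a sequent. -/
def V (a b : ℤ) (Γ Δ : Multiset MForm) : Prop :=
  ∀ x ∈ S (P a b) Γ, ∀ y ∈ S (N a b) Δ, x + y = 0

lemma V_left {a b : ℤ} {A Γ Δ} : V a b (A ::ₘ Γ) Δ ↔
    ∀ x ∈ S (P a b) Γ, ∀ y ∈ S (N a b) Δ, x + y ∈ N a b A := by
  constructor
  · intro h x hx y hy u hu
    have := h (u + x) (S_cons.2 ⟨u, hu, x, hx, rfl⟩) y hy
    omega
  · intro h x hx y hy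
    obtain ⟨u, hu, v, hv, rfl⟩ := S_cons.1 hx
    have := h v hv y hy u hu
    omega

lemma V_right {a b : ℤ} {A Γ Δ} : V a b Γ (A ::ₘ Δ) ↔
    ∀ x ∈ S (P a b) Γ, ∀ y ∈ S (N a b) Δ, x + y ∈ P a b A := by
  constructor
  · intro h x hx y hy
    rw [← closed]
    intro u hu
    have := h x hx (u + y) (S_cons.2 ⟨u, hu, y, hy, rfl⟩)
    omega
  · intro h x hx y hy
    obtain ⟨u, hu, v, hv, rfl⟩ := S_cons.1 hy
    have := hu _ (h x hx v hv)
    omega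

theorem sound (a b : ℤ) {Γ Δ} (h : MDeriv Γ Δ) : V a b Γ Δ := by
  induction h with
  | ax A =>
    intro x hx y hy
    exact S_single.1 hy x (S_single.1 hx)
  | cut _ _ h1 h2 =>
    rw [V_left] at h1
    rw [V_right] at h2
    intro x hx y hy
    obtain ⟨x1, hx1, x2, hx2, rfl⟩ := S_add.1 hx
    obtain ⟨y1, hy1, y2, hy2, rfl⟩ := S_add.1 hy
    have := h1 x1 hx1 y1 hy1 _ (h2 x2 hx2 y2 hy2)
    omega
  | negL _ h =>
    rw [V_right] at h
    rw [V_left]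
    intro x hx y hy
    simp only [N, P, closed]
    exact h x hx y hy
  | negR _ h =>
    rw [V_left] at h
    rw [V_right]
    exact h
  | tensR _ _ h1 h2 =>
    rw [V_right] at h1 h2 ⊢
    intro x hx y hy
    obtain ⟨x1, hx1, x2, hx2, rfl⟩ := S_add.1 hx
    obtain ⟨y1, hy1, y2, hy2, rfl⟩ := S_add.1 hy
    exact sub_orth2 _ ⟨_, h1 x1 hx1 y1 hy1, _, h2 x2 hx2 y2 hy2, by omega⟩
  | tensL _ h =>
    rw [V_left] at h ⊢
    intro x hx y hy
    simp only [N, P, orth3]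
    rintro z ⟨u, hu, v, hv, rfl⟩
    have := h (v + x) (S_cons.2 ⟨v, hv, x, hx, rfl⟩) y hy u hu
    omega
  | parrL _ _ h1 h2 =>
    rw [V_left] at h1 h2 ⊢
    intro x hx y hy
    obtain ⟨x1, hx1, x2, hx2, rfl⟩ := S_add.1 hx
    obtain ⟨y1, hy1, y2, hy2, rfl⟩ := S_add.1 hy
    exact sub_orth2 _ ⟨_, h1 x1 hx1 y1 hy1, _, h2 x2 hx2 y2 hy2, by omega⟩
  | parrR _ h =>
    rw [V_right]
    intro x hx y hy
    rintro z ⟨u, hu, v, hv, rfl⟩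
    have := h x hx (u + (v + y)) (S_cons.2 ⟨u, hu, _, S_cons.2 ⟨v, hv, y, hy, rfl⟩, rfl⟩)
    omega
  | lolliL _ _ h1 h2 =>
    rw [V_right] at h1
    rw [V_left] at h2 ⊢
    intro x hx y hy
    obtain ⟨x1, hx1, x2, hx2, rfl⟩ := S_add.1 hx
    obtain ⟨y1, hy1, y2, hy2, rfl⟩ := S_add.1 hy
    exact sub_orth2 _ ⟨_, h1 x1 hx1 y1 hy1, _, h2 x2 hx2 y2 hy2, by omega⟩
  | lolliR _ h =>
    rw [V_right]
    intro x hx y hy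
    rintro z ⟨u, hu, v, hv, rfl⟩
    have := h (u + x) (S_cons.2 ⟨u, hu, x, hx, rfl⟩) (v + y) (S_cons.2 ⟨v, hv, y, hy, rfl⟩)
    omega
  | oneR =>
    intro x hx y hy
    rw [S_zero] at hx
    rw [S_single] at hy
    have := hy 0 rfl
    omega
  | oneL _ h =>
    rw [V_left]
    intro x hx y hy u hu
    have := h x hx y hy
    simp only [P, Set.mem_singleton_iff] at hu
    omega
  | botL =>
    intro x hx y hy
    rw [S_zero] at hy
    rw [S_single] at hx
    simp only [P, Set.mem_singleton_iff] at hx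
    omega
  | botR _ h =>
    rw [V_right]
    intro x hx y hy
    exact h x hx y hy
  | withR _ _ h1 h2 =>
    rw [V_right] at h1 h2 ⊢
    intro x hx y hy
    exact ⟨h1 x hx y hy, h2 x hx y hy⟩
  | withL1 _ h =>
    rw [V_left] at h ⊢
    intro x hx y hy
    exact orth_anti Set.inter_subset_left (h x hx y hy)
  | withL2 _ h =>
    rw [V_left] at h ⊢
    intro x hx y hy
    exact orth_anti Set.inter_subset_right (h x hx y hy)
  | plusL _ _ h1 h2 =>
    rw [V_left] at h1 h2 ⊢
    intro x hx y hy
    exact sub_orth2 _ ⟨h1 x hx y hy, h2 x hx y hy⟩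
  | plusR1 _ h =>
    rw [V_right] at h ⊢
    intro x hx y hy
    exact orth_anti Set.inter_subset_left (sub_orth2 _ (h x hx y hy))
  | plusR2 _ h =>
    rw [V_right] at h ⊢
    intro x hx y hy
    exact orth_anti Set.inter_subset_right (sub_orth2 _ (h x hx y hy))
  | topR Γ Δ =>
    rw [V_right]
    intro x hx y hy
    trivial
  | zeroL Γ Δ =>
    rw [V_left]
    intro x hx y hy u hu
    exact hu.elim

/-- Integer weight of the agenda formulas. -/
def w (a b : ℤ) : MForm → ℤ
  | .atom n => if n = 0 then a else b
  | .neg A => - w a b A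
  | .lolli A _ => - w a b A
  | _ => 0

lemma w_mem (a b : ℤ) {A : MForm} (h : A ∈ Φ) : P a b A = {w a b A} := by
  have hl : {z : ℤ | b + 0 = z} = {b} := by ext z; simp [eq_comm]
  simp only [Φ, Finset.mem_insert, Finset.mem_singleton] at h
  rcases h with rfl | rfl | rfl | rfl | rfl | rfl <;>
    simp [P, w, p, c, orth_singleton]

lemma sum_eq_zero (a b : ℤ) {Y : Finset MForm} (hY : Y ⊆ Φ) (h : MInconsistent Y.val) :
    ∑ A ∈ Y, w a b A = 0 := by
  have h1 := sound a b h (∑ A ∈ Y, w a b A) (by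
    clear h
    induction Y using Finset.induction_on with
    | empty => simp [S]
    | insert A Y hA ih =>
      rw [Finset.sum_insert hA, Finset.insert_val_of_notMem hA, S_cons]
      refine ⟨_, ?_, _, ih ((Finset.subset_insert _ _).trans hY), rfl⟩
      rw [w_mem a b (hY (Finset.mem_insert_self _ _))]
      rfl) 0 (S_zero.2 rfl)
  omega

lemma pair_incons (A : MForm) : MInconsistent ({A, .neg A} : Finset MForm).val := by
  have hne : A ≠ .neg A := by
    intro h
    have := congrArg sizeOf h
    simp at this
  have : ({A, .neg A} : Finset MForm).val = .neg A ::ₘ {A} := by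
    rw [Finset.insert_val_of_notMem (by simpa using hne)]
    exact Multiset.cons_swap A A.neg 0
  rw [this]
  exact MDeriv.negL (MDeriv.ax A)

lemma no_pair {Y : Finset MForm} (hY : minimallyInconsistent Y) (hc : 2 < Y.card) (A : MForm)
    (h1 : A ∈ Y) (h2 : MForm.neg A ∈ Y) : False := by
  refine hY.2 {A, .neg A} ?_ (pair_incons A)
  refine Finset.ssubset_iff_subset_ne.2 ⟨?_, ?_⟩
  · intro x hx
    simp only [Finset.mem_insert, Finset.mem_singleton] at hx
    rcases hx with rfl | rfl <;> assumption
  · rintro rfl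
    have := Finset.card_le_two (a := A) (b := .neg A)
    omega

lemma median : medianProperty Φ := by
  intro Y hY hm
  by_contra hc
  rw [not_le] at hc
  have n1 := no_pair hm hc p
  have n2 := no_pair hm hc c
  have n3 := no_pair hm hc (c.lolli .one)
  have hs := sum_eq_zero 1 0 hY hm.1
  have hY' : Y = Φ.filter (fun A => A ∈ Y) := by
    ext x
    simp only [Finset.mem_filter]
    exact ⟨fun h => ⟨hY h, h⟩, fun h => h.2⟩
  have e1 : ∀ f : MForm → ℤ, ∑ A ∈ Y, f A = (if p ∈ Y then f p else 0) +
      ((if p.neg ∈ Y then f p.neg else 0) + ((if c ∈ Y then f c else 0) +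
      ((if c.neg ∈ Y then f c.neg else 0) +
      ((if c.lolli .one ∈ Y then f (c.lolli .one) else 0) +
      (if (c.lolli .one).neg ∈ Y then f (c.lolli .one).neg else 0))))) := by
    intro f
    conv_lhs => rw [hY']
    rw [Finset.sum_filter, Φ]
    repeat rw [Finset.sum_insert (by simp [p, c])]
    rw [Finset.sum_singleton]
  have hcard : (Y.card : ℤ) = ∑ A ∈ Y, 1 := by simp
  rw [e1] at hs hcard
  have w1 : w 1 0 p = 1 := rfl
  have w2 : w 1 0 p.neg = -1 := rfl
  have w3 : w 1 0 c = 0 := rfl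
  have w4 : w 1 0 c.neg = 0 := rfl
  have w5 : w 1 0 (c.lolli .one) = 0 := rfl
  have w6 : w 1 0 (c.lolli .one).neg = 0 := rfl
  rw [w1, w2, w3, w4, w5, w6] at hs
  clear hY' e1
  by_cases h1 : p ∈ Y <;> by_cases h2 : p.neg ∈ Y
  · exact n1 h1 h2
  · simp [h1, h2] at hs
  · simp [h1, h2] at hs
  · rw [if_neg h1, if_neg h2] at hcard
    by_cases h3 : c ∈ Y <;> by_cases h4 : c.neg ∈ Y <;>
    by_cases h5 : c.lolli .one ∈ Y <;> by_cases h6 : (c.lolli .one).neg ∈ Y <;>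
    first
    | exact n2 h3 h4
    | exact n3 h5 h6
    | simp only [h3, h4, h5, h6, if_true, if_false] at hcard
      omega

lemma big_incons : MDeriv ({p, .neg p, c, c.lolli .one} : Finset MForm).val 0 := by
  have e : ({p, .neg p, c, c.lolli .one} : Finset MForm).val =
      c.lolli .one ::ₘ ({c} + (.neg p ::ₘ {p})) := by decide
  rw [e]
  exact MDeriv.lolliL (Δ := 0) (Δ' := 0) (MDeriv.ax c)
    (MDeriv.oneL (MDeriv.negL (MDeriv.ax p)))

lemma J_sub : ∀ i, Jprof i ⊆ Φ := by decide

/-- the MALL agenda {p,¬p,c,¬c,c⊸1,¬(c⊸1)} satisfies the median property;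
the profile J₁ = {p,¬p,c}, J₂ = {p,c,c⊸1}, J₃ = {¬p,c,c⊸1} consists of MALL-consistent
(but not robustly consistent) judgment sets, and the majority outcome {p,¬p,c,c⊸1} is
MALL-inconsistent: the sequent p, ¬p, c, c⊸1 ⊢ is derivable in MALL. -/
theorem median_property_insufficient_for_mere_consistency :
    medianProperty Φ ∧
    (∀ i, Jprof i ⊆ Φ ∧ ¬ MInconsistent (Jprof i).val) ∧
    ¬ (∀ i, robustlyConsistent (Jprof i).val) ∧
    maj 3 Φ Jprof = {p, .neg p, c, c.lolli .one} ∧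
    MDeriv ({p, .neg p, c, c.lolli .one} : Finset MForm).val 0 := by
  refine ⟨median, fun i => ⟨J_sub i, fun h => ?_⟩, fun h => ?_, by decide, big_incons⟩
  · have h1 := sum_eq_zero 1 0 (J_sub i) h
    have h2 := sum_eq_zero 0 1 (J_sub i) h
    revert h1 h2
    clear h
    revert i
    decide
  · refine h 0 ({p, .neg p} : Finset MForm).val ?_ (pair_incons p)
    decide

end Stmt10
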